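/- arXiv:2503.06328 — 4 statements merged into one kernel-verified Lean document; each statement's English description precedes it below -/
import Mathlib

section
/- Let k and n be positive integers and δ ≥ 0. Let (F^noise_i)_{i=1}^k and (F^ideal_i)_{i=1}^k be POVMs on ℂ^n such that the operator norm satisfies ‖F^noise_i − F^ideal_i‖∞ ≤ δ for every i. Define F^noisier_i := (1/(1+kδ))·F^noise_i + (δ/(1+kδ))·I. Then (F^noisier_i)_{i=1}^k is a POVM on ℂ^n, and for every i the matrix F^noisier_i − (1/(1+kδ))·F^ideal_i is positive semidefinite. -/
open Matrix ComplexOrder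

/-- The "noisier" POVM elements `F^noisier_i := (1/(1+kδ))·F^noise_i + (δ/(1+kδ))·I`. -/
noncomputable def Fnoisier (k n : ℕ) (δ : ℝ) (Fnoise : Fin k → Matrix (Fin n) (Fin n) ℂ)
    (i : Fin k) : Matrix (Fin n) (Fin n) ℂ :=
  ((1 / (1 + (k : ℝ) * δ) : ℝ) : ℂ) • Fnoise i +
    ((δ / (1 + (k : ℝ) * δ) : ℝ) : ℂ) • (1 : Matrix (Fin n) (Fin n) ℂ)

/-- Adding `δ` times the identity to a Hermitian matrix of operator norm at most `δ` yields a
positive semidefinite matrix. -/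
theorem posSemidef_add_smul_one_of_opNorm_le {n : Type*} [Fintype n] [DecidableEq n]
    {A : Matrix n n ℂ} (hA : A.IsHermitian) {δ : ℝ}
    (hδ : ‖Matrix.toEuclideanCLM (𝕜 := ℂ) A‖ ≤ δ) :
    (A + (δ : ℂ) • (1 : Matrix n n ℂ)).PosSemidef := by
  have hB : (A + (δ : ℂ) • (1 : Matrix n n ℂ)).IsHermitian := by
    refine hA.add ?_
    simp [Matrix.IsHermitian, Matrix.conjTranspose_smul]
  rw [Matrix.posSemidef_iff_dotProduct_mulVec]
  refine ⟨hB, fun x => ?_⟩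
  have him := hB.im_star_dotProduct_mulVec_self x
  have hre : 0 ≤ (star x ⬝ᵥ (A + (δ : ℂ) • (1 : Matrix n n ℂ)) *ᵥ x).re := by
    set v : EuclideanSpace ℂ n := WithLp.toLp 2 x
    have hinner : star x ⬝ᵥ A *ᵥ x = inner ℂ v (Matrix.toEuclideanCLM (𝕜 := ℂ) A v) := by
      simp [v, EuclideanSpace.inner_eq_star_dotProduct, dotProduct_comm]
    have hself : star x ⬝ᵥ x = ((‖v‖ ^ 2 : ℝ) : ℂ) := by
      have h := inner_self_eq_norm_sq_to_K (𝕜 := ℂ) v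
      rw [EuclideanSpace.inner_eq_star_dotProduct] at h
      rw [dotProduct_comm]
      simpa [v] using h
    have hbound : ‖(inner ℂ v (Matrix.toEuclideanCLM (𝕜 := ℂ) A v) : ℂ)‖ ≤ δ * ‖v‖ ^ 2 := by
      calc _ ≤ ‖v‖ * ‖Matrix.toEuclideanCLM (𝕜 := ℂ) A v‖ := norm_inner_le_norm _ _
        _ ≤ ‖v‖ * (δ * ‖v‖) := by
          gcongr
          exact ContinuousLinearMap.le_of_opNorm_le _ hδ v
        _ = δ * ‖v‖ ^ 2 := by ring
    have habs := (abs_le.mp ((Complex.abs_re_le_norm _).trans hbound)).1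
    rw [add_mulVec, smul_mulVec, one_mulVec, dotProduct_add, dotProduct_smul, hself, hinner,
      smul_eq_mul, ← Complex.ofReal_mul, Complex.add_re, Complex.ofReal_re]
    linarith
  exact Complex.nonneg_iff.mpr ⟨hre, him.symm⟩

/-- Let `(F^noise_i)` and `(F^ideal_i)` be POVMs on `ℂ^n` with
`‖F^noise_i − F^ideal_i‖∞ ≤ δ` (operator norm) for every `i`. Then the family
`F^noisier_i := (1/(1+kδ))·F^noise_i + (δ/(1+kδ))·I` is a POVM on `ℂ^n`, and for every `i`
the matrix `F^noisier_i − (1/(1+kδ))·F^ideal_i` is positive semidefinite. -/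
theorem noisier_povm_dominates_ideal (k n : ℕ) (hk : 0 < k) (hn : 0 < n) (δ : ℝ) (hδ : 0 ≤ δ)
    (Fnoise Fideal : Fin k → Matrix (Fin n) (Fin n) ℂ)
    (hNpsd : ∀ i, (Fnoise i).PosSemidef) (hNsum : ∑ i, Fnoise i = 1)
    (hIpsd : ∀ i, (Fideal i).PosSemidef) (hIsum : ∑ i, Fideal i = 1)
    (hnorm : ∀ i, ‖Matrix.toEuclideanCLM (𝕜 := ℂ) (Fnoise i - Fideal i)‖ ≤ δ) :
    (∀ i, (Fnoisier k n δ Fnoise i).PosSemidef) ∧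
    (∑ i, Fnoisier k n δ Fnoise i = 1) ∧
    (∀ i, (Fnoisier k n δ Fnoise i -
      ((1 / (1 + (k : ℝ) * δ) : ℝ) : ℂ) • Fideal i).PosSemidef) := by
  have hden : 0 < 1 + (k : ℝ) * δ := by positivity
  have hscale : (0 : ℂ) ≤ ((1 / (1 + (k : ℝ) * δ) : ℝ) : ℂ) := by
    rw [Complex.zero_le_real]
    positivity
  have hshift : (0 : ℂ) ≤ ((δ / (1 + (k : ℝ) * δ) : ℝ) : ℂ) := by
    rw [Complex.zero_le_real]
    positivity
  refine ⟨fun i => ?_, ?_, fun i => ?_⟩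
  · exact ((hNpsd i).smul hscale).add (Matrix.PosSemidef.one.smul hshift)
  · simp only [Fnoisier, Finset.sum_add_distrib, ← Finset.smul_sum, hNsum, Finset.sum_const,
      Finset.card_univ, Fintype.card_fin]
    rw [← Nat.cast_smul_eq_nsmul ℂ, smul_smul, ← add_smul, ← Complex.ofReal_natCast,
      ← Complex.ofReal_mul, ← Complex.ofReal_add]
    have hone : 1 / (1 + (k : ℝ) * δ) + δ / (1 + (k : ℝ) * δ) * k = 1 := by
      rw [div_mul_eq_mul_div, mul_comm δ, ← add_div, div_self hden.ne']
    rw [hone, Complex.ofReal_one, one_smul]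
  · have hfactor : Fnoisier k n δ Fnoise i - ((1 / (1 + (k : ℝ) * δ) : ℝ) : ℂ) • Fideal i =
        ((1 / (1 + (k : ℝ) * δ) : ℝ) : ℂ) •
          ((Fnoise i - Fideal i) + (δ : ℂ) • (1 : Matrix (Fin n) (Fin n) ℂ)) := by
      rw [Fnoisier, smul_add, smul_sub, smul_smul, ← Complex.ofReal_mul, one_div_mul_eq_div]
      abel
    rw [hfactor]
    exact (posSemidef_add_smul_one_of_opNorm_le
      ((hNpsd i).isHermitian.sub (hIpsd i).isHermitian) (hnorm i)).smul hscale
end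

section
/- Let k be a positive integer and let 0 < η_min ≤ η_max ≤ 1. Let η = (η_1, …, η_k) be a vector with η_min ≤ η_j ≤ η_max for all j, and let η̄ satisfy η_min/(1−(η_max−η_min)) ≤ η̄ ≤ 1 and η_min < η̄. For any vector μ = (μ_1,…,μ_k) ∈ [0,1]^k define the (k+1)×(k+1) matrix P^μ (rows and columns indexed by {0,1,…,k}) by: (P^μ)_{0,0} = 1, (P^μ)_{j,0} = 0 for j ≥ 1, (P^μ)_{0,j} = 1−μ_j and (P^μ)_{j,j} = μ_j for j ≥ 1, and all other entries zero. Define the (k+1)×(k+1) matrix Q by: Q_{0,0} = 1, Q_{j,0} = 0 for j ≥ 1, Q_{j,j} = η̄·(η_j−η_min)/(η̄−η_min) and Q_{0,j} = 1 − η̄·(η_j−η_min)/(η̄−η_min) for j ≥ 1, and all other entries zero. Then Q is column-stochastic (in particular all its entries lie in [0,1]), and P^η = (η_min/η̄)·P^{(η̄,…,η̄)} + (1 − η_min/η̄)·Q. -/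
open Matrix

/-- The classical post-processing induced on the no-more-than-one-photon subspace by `k`
threshold detectors with efficiencies `μ_1, …, μ_k`: outcome `Sum.inl ()` is the no-click
event and `Sum.inr j` is a click in detector `j`. -/
def lossPP {k : ℕ} (μ : Fin k → ℝ) :
    Matrix (Unit ⊕ Fin k) (Unit ⊕ Fin k) ℝ :=
  Matrix.of fun i j =>
    match i, j with
    | Sum.inl _, Sum.inl _ => 1
    | Sum.inr _, Sum.inl _ => 0
    | Sum.inl _, Sum.inr j => 1 - μ j
    | Sum.inr i, Sum.inr j => if i = j then μ j else 0

/-- The residual post-processing `Q` appearing in the decomposition of the loss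
post-processing. -/
noncomputable def lossResidual {k : ℕ} (η : Fin k → ℝ) (ηmin ηbar : ℝ) :
    Matrix (Unit ⊕ Fin k) (Unit ⊕ Fin k) ℝ :=
  Matrix.of fun i j =>
    match i, j with
    | Sum.inl _, Sum.inl _ => 1
    | Sum.inr _, Sum.inl _ => 0
    | Sum.inl _, Sum.inr j => 1 - ηbar * (η j - ηmin) / (ηbar - ηmin)
    | Sum.inr i, Sum.inr j => if i = j then ηbar * (η j - ηmin) / (ηbar - ηmin) else 0

/-- Decomposition of the loss post-processing.
With `0 < η_min ≤ η_j ≤ η_max ≤ 1` and `η_min/(1−(η_max−η_min)) ≤ η̄ ≤ 1`, `η_min < η̄`,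
the matrix `Q` is column-stochastic (in particular all its entries lie in `[0,1]`) and
`P^η = (η_min/η̄)·P^{(η̄,…,η̄)} + (1 − η_min/η̄)·Q`. -/
theorem loss_pp_decomposition (k : ℕ) (hk : 0 < k)
    (ηmin ηmax : ℝ) (hmin : 0 < ηmin) (hminmax : ηmin ≤ ηmax) (hmax : ηmax ≤ 1)
    (η : Fin k → ℝ) (hηlo : ∀ j, ηmin ≤ η j) (hηhi : ∀ j, η j ≤ ηmax)
    (ηbar : ℝ) (hbarlo : ηmin / (1 - (ηmax - ηmin)) ≤ ηbar) (hbarhi : ηbar ≤ 1)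
    (hbar : ηmin < ηbar) :
    (∀ i j, 0 ≤ lossResidual η ηmin ηbar i j ∧ lossResidual η ηmin ηbar i j ≤ 1) ∧
    (∀ j, ∑ i, lossResidual η ηmin ηbar i j = 1) ∧
    lossPP η = (ηmin / ηbar) • lossPP (fun _ => ηbar) +
      (1 - ηmin / ηbar) • lossResidual η ηmin ηbar := by
  have hbar0 : 0 < ηbar := hmin.trans hbar
  have hgap : 0 < ηbar - ηmin := sub_pos.2 hbar
  have hq0 (j) : 0 ≤ ηbar * (η j - ηmin) / (ηbar - ηmin) :=
    div_nonneg (mul_nonneg hbar0.le (sub_nonneg.2 (hηlo j))) hgap.le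
  have hq1 (j) : ηbar * (η j - ηmin) / (ηbar - ηmin) ≤ 1 := by
    rw [div_le_iff₀ (by linarith)] at hbarlo
    rw [div_le_one hgap]
    nlinarith [mul_le_mul_of_nonneg_left (hηhi j) hbar0.le]
  have hmix (j) : η j = ηmin / ηbar * ηbar +
      (1 - ηmin / ηbar) * (ηbar * (η j - ηmin) / (ηbar - ηmin)) := by
    field_simp
    ring
  refine ⟨?_, ?_, ?_⟩
  · rintro (_ | i) (_ | j)
    · simp [lossResidual]
    · exact ⟨sub_nonneg.2 (hq1 j), sub_le_self _ (hq0 j)⟩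
    · simp [lossResidual]
    · simp only [lossResidual, Matrix.of_apply]
      split_ifs
      · exact ⟨hq0 j, hq1 j⟩
      · exact ⟨le_rfl, zero_le_one⟩
  · rintro (_ | j) <;> simp [lossResidual]
  · ext (_ | i) (_ | j)
    · simp [lossPP, lossResidual]
    · simp only [lossPP, lossResidual, Matrix.add_apply, Matrix.smul_apply, Matrix.of_apply,
        smul_eq_mul]
      linarith [hmix j]
    · simp [lossPP, lossResidual]
    · simp only [lossPP, lossResidual, Matrix.add_apply, Matrix.smul_apply, Matrix.of_apply,
        smul_eq_mul]
      split_ifs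
      · exact hmix j
      · simp
end

section
/- Let U = {0} ⊔ S ⊔ M be a finite outcome set consisting of the no-click event 0, a set S of single-click events, and a set M of multi-click events. Let P be a column-stochastic U×U real matrix satisfying: (a) P_{s,s'} = 0 for all distinct s, s' ∈ S; (b) P_{0,i} = 0 for all i ≠ 0; and (c) P_{s,s} ≥ P_{0,0} for all s ∈ S; and assume P_{0,0} < 1. Let p = (p_j)_{j∈U} be a probability vector (nonnegative entries summing to 1) with p_m = 0 for all m ∈ M. Define the vector t = (t_i)_{i∈U} by: t_0 = 0; t_s = (P_{s,0}·p_0 + (P_{s,s} − P_{0,0})·p_s)/(1 − P_{0,0}) for s ∈ S; and t_m = (Σ_{j∉M} P_{m,j}·p_j)/(1 − P_{0,0}) for m ∈ M. Then t is a probability vector: all its entries are nonnegative and Σ_{i∈U} t_i = 1. -/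
/-- The embedding of the non-multi-click outcomes `{0} ⊔ S` into `U = {0} ⊔ S ⊔ M`. -/
def embNotMulti {S M : Type} : Unit ⊕ S → Unit ⊕ S ⊕ M :=
  Sum.map id Sum.inl

/-- The distribution `t` of the classical flag state `τ_C` prepared by the dark count noise
channel on the branch where a dark count occurs: `t_0 = 0`,
`t_s = (P_{s,0}·p_0 + (P_{s,s} − P_{0,0})·p_s)/(1 − P_{0,0})` for `s ∈ S`, and
`t_m = (Σ_{j∉M} P_{m,j}·p_j)/(1 − P_{0,0})` for `m ∈ M`. -/
noncomputable def flagDist {S M : Type} [Fintype S] [Fintype M]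
    (P : Matrix (Unit ⊕ S ⊕ M) (Unit ⊕ S ⊕ M) ℝ)
    (p : Unit ⊕ S ⊕ M → ℝ) : Unit ⊕ S ⊕ M → ℝ :=
  fun i =>
    match i with
    | Sum.inl _ => 0
    | Sum.inr (Sum.inl s) =>
        (P (Sum.inr (Sum.inl s)) (Sum.inl ()) * p (Sum.inl ()) +
          (P (Sum.inr (Sum.inl s)) (Sum.inr (Sum.inl s)) -
            P (Sum.inl ()) (Sum.inl ())) * p (Sum.inr (Sum.inl s))) /
        (1 - P (Sum.inl ()) (Sum.inl ()))
    | Sum.inr (Sum.inr m) =>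
        (∑ j : Unit ⊕ S,
          P (Sum.inr (Sum.inr m)) (embNotMulti j) * p (embNotMulti j)) /
        (1 - P (Sum.inl ()) (Sum.inl ()))

/-- For a column-stochastic dark count post-processing `P` on
`U = {0} ⊔ S ⊔ M` satisfying (a) `P_{s,s'} = 0` for distinct `s, s' ∈ S`,
(b) `P_{0,i} = 0` for `i ≠ 0`, (c) `P_{s,s} ≥ P_{0,0}` for `s ∈ S`, with `P_{0,0} < 1`,
and a probability vector `p` with `p_m = 0` for all `m ∈ M`, the vector `t` is a
probability vector: all its entries are nonnegative and they sum to `1`. -/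
theorem flagDist_isProbability
    (S M : Type) [Fintype S] [DecidableEq S] [Fintype M] [DecidableEq M]
    (P : Matrix (Unit ⊕ S ⊕ M) (Unit ⊕ S ⊕ M) ℝ)
    (hPnn : ∀ i j, 0 ≤ P i j)
    (hPcol : ∀ j, ∑ i, P i j = 1)
    (ha : ∀ s s' : S, s ≠ s' →
      P (Sum.inr (Sum.inl s)) (Sum.inr (Sum.inl s')) = 0)
    (hb : ∀ i, i ≠ Sum.inl () → P (Sum.inl ()) i = 0)
    (hc : ∀ s : S, P (Sum.inl ()) (Sum.inl ()) ≤
      P (Sum.inr (Sum.inl s)) (Sum.inr (Sum.inl s)))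
    (hP00 : P (Sum.inl ()) (Sum.inl ()) < 1)
    (p : Unit ⊕ S ⊕ M → ℝ)
    (hpnn : ∀ j, 0 ≤ p j) (hpsum : ∑ j, p j = 1)
    (hpM : ∀ m : M, p (Sum.inr (Sum.inr m)) = 0) :
    (∀ i, 0 ≤ flagDist P p i) ∧ ∑ i, flagDist P p i = 1 := by
  have hpos : 0 < 1 - P (Sum.inl ()) (Sum.inl ()) := sub_pos.mpr hP00
  constructor
  · rintro (_ | s | m)
    · exact le_rfl
    · exact div_nonneg (add_nonneg (mul_nonneg (hPnn _ _) (hpnn _))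
        (mul_nonneg (sub_nonneg.mpr (hc s)) (hpnn _))) hpos.le
    · exact div_nonneg (Finset.sum_nonneg fun j _ => mul_nonneg (hPnn _ _) (hpnn _)) hpos.le
  · have col_zero := hPcol (Sum.inl ())
    have col_single (s : S) : ∑ m, P (Sum.inr (Sum.inr m)) (Sum.inr (Sum.inl s)) =
        1 - P (Sum.inr (Sum.inl s)) (Sum.inr (Sum.inl s)) := by
      have h := hPcol (Sum.inr (Sum.inl s))
      have h_diag : ∑ s', P (Sum.inr (Sum.inl s')) (Sum.inr (Sum.inl s)) =
          P (Sum.inr (Sum.inl s)) (Sum.inr (Sum.inl s)) :=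
        Fintype.sum_eq_single s fun s' hs' => ha s' s hs'
      have h_zero := hb (Sum.inr (Sum.inl s)) (by simp)
      simp only [Fintype.sum_sum_type, Finset.univ_unique, Finset.sum_singleton,
        PUnit.default_eq_unit] at h
      linarith
    simp only [Fintype.sum_sum_type, Finset.univ_unique, Finset.sum_singleton,
      PUnit.default_eq_unit, hpM, Finset.sum_const_zero, add_zero] at col_zero hpsum
    simp only [Fintype.sum_sum_type, Finset.univ_unique, Finset.sum_singleton,
      PUnit.default_eq_unit, flagDist, embNotMulti, Sum.map_inl, Sum.map_inr, id_eq, zero_add]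
    rw [← Finset.sum_div, ← Finset.sum_div, ← add_div, div_eq_one_iff_eq hpos.ne']
    simp only [Finset.sum_add_distrib]
    rw [Finset.sum_comm (s := (Finset.univ : Finset M))]
    simp only [← Finset.sum_mul, col_single, sub_mul, one_mul, Finset.sum_sub_distrib,
      ← Finset.mul_sum]
    linear_combination p (Sum.inl ()) * col_zero +
      (1 - P (Sum.inl ()) (Sum.inl ())) * hpsum
end

section
/- Let d₁, d₂ ∈ [0,1]. Define the 4×4 real matrix P_db (rows and columns indexed by the click patterns: no-click, detector-1 click, detector-2 click, double click) by P_db = [[(1−d₁)(1−d₂), 0, 0, 0], [d₁(1−d₂), 1−d₂, 0, 0], [d₂(1−d₁), 0, 1−d₁, 0], [d₁d₂, d₂, d₁, 1]], and the 3×4 real matrix P_sq = [[1, 0, 0, 0], [0, 1, 0, 1/2], [0, 0, 1, 1/2]]. Then there exists a 3×3 column-stochastic real matrix P_dc satisfying P_sq · P_db = P_dc · P_sq if and only if d₁ = d₂. Moreover, when d₁ = d₂ = d, the matrix P_dc = [[(1−d)², 0, 0], [d(1−d/2), 1−d/2, d/2], [d(1−d/2), d/2, 1−d/2]] satisfies P_sq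 · P_db = P_dc · P_sq. -/
open Matrix

/-- The dark count post-processing for an active BB84 detection setup with two threshold
detectors having dark count rates `d₁` and `d₂`; rows/columns are indexed by the click
patterns (no-click, detector-1 click, detector-2 click, double click). -/
def Pdb (d₁ d₂ : ℝ) : Matrix (Fin 4) (Fin 4) ℝ :=
  !![(1 - d₁) * (1 - d₂), 0, 0, 0;
     d₁ * (1 - d₂), 1 - d₂, 0, 0;
     d₂ * (1 - d₁), 0, 1 - d₁, 0;
     d₁ * d₂, d₂, d₁, 1]

/-- The squashing post-processing that maps double clicks to uniformly random single
clicks. -/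
noncomputable def Psq : Matrix (Fin 3) (Fin 4) ℝ :=
  !![1, 0, 0, 0;
     0, 1, 0, 1/2;
     0, 0, 1, 1/2]

/-- The candidate post-processed dark count matrix for equal dark count rate `d`. -/
noncomputable def PdcExplicit (d : ℝ) : Matrix (Fin 3) (Fin 3) ℝ :=
  !![(1 - d)^2, 0, 0;
     d * (1 - d/2), 1 - d/2, d/2;
     d * (1 - d/2), d/2, 1 - d/2]

theorem Psq_mul_Pdb_self (d : ℝ) : Psq * Pdb d d = PdcExplicit d * Psq := by
  ext i j
  fin_cases i <;> fin_cases j <;>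
    simp [Psq, Pdb, PdcExplicit, Matrix.mul_apply, Fin.sum_univ_succ] <;> ring

theorem PdcExplicit_nonneg {d : ℝ} (hd : d ∈ Set.Icc (0 : ℝ) 1) (i j : Fin 3) :
    0 ≤ PdcExplicit d i j := by
  obtain ⟨h0, h1⟩ := hd
  have h : 0 ≤ 1 - d / 2 := by linarith
  fin_cases i <;> fin_cases j <;> simp [PdcExplicit] <;> first | positivity | linarith

theorem sum_PdcExplicit (d : ℝ) (j : Fin 3) : ∑ i, PdcExplicit d i j = 1 := by
  fin_cases j <;> simp [PdcExplicit, Fin.sum_univ_succ] <;> ring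

theorem eq_of_Psq_mul_Pdb_eq {d₁ d₂ : ℝ} {P : Matrix (Fin 3) (Fin 3) ℝ}
    (h : Psq * Pdb d₁ d₂ = P * Psq) : d₁ = d₂ := by
  have e1 := congrFun (congrFun h 1) 1
  have e2 := congrFun (congrFun h 1) 2
  have e3 := congrFun (congrFun h 1) 3
  simp [Psq, Pdb, Matrix.mul_apply, Fin.sum_univ_succ] at e1 e2 e3
  linarith

/-- There exists a column-stochastic `3×3` matrix `P_dc` with
`P_sq · P_db = P_dc · P_sq` if and only if `d₁ = d₂`; moreover when `d₁ = d₂ = d` the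
explicit matrix `PdcExplicit d` satisfies `P_sq · P_db = P_dc · P_sq`. -/
theorem bb84_swap_iff_equal_dark_counts
    (d₁ d₂ : ℝ) (h₁ : d₁ ∈ Set.Icc (0 : ℝ) 1) (h₂ : d₂ ∈ Set.Icc (0 : ℝ) 1) :
    ((∃ Pdc : Matrix (Fin 3) (Fin 3) ℝ,
        (∀ i j, 0 ≤ Pdc i j) ∧ (∀ j, ∑ i, Pdc i j = 1) ∧
        Psq * Pdb d₁ d₂ = Pdc * Psq) ↔ d₁ = d₂) ∧
    (∀ d : ℝ, d₁ = d → d₂ = d → Psq * Pdb d₁ d₂ = PdcExplicit d * Psq) := by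
  refine ⟨⟨fun ⟨_, _, _, h⟩ => eq_of_Psq_mul_Pdb_eq h, ?_⟩, ?_⟩
  · rintro rfl
    exact ⟨PdcExplicit d₁, PdcExplicit_nonneg h₁, sum_PdcExplicit d₁, Psq_mul_Pdb_self d₁⟩
  · rintro d rfl rfl
    exact Psq_mul_Pdb_self _
end
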